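/- Let x > 0 and 0 < y₀ ≤ 1. Suppose F : (0, y₀] → (0,∞) is continuously differentiable and strictly increasing, satisfies lim_{s→0⁺} F(s) = 0, satisfies x·F(s)³ ≤ 27/256 for all s ∈ (0,y₀], and satisfies the inverse-function relation F(s) · exp(−(x³/6) · (F(s) + T₀(x,F(s)))⁹) = s for all s ∈ (0,y₀]. Write F = F(y₀), L = θ(x F³) and H = T₀(x,F). Then the improper integral (x²/2) · ∫₀^{y₀} (T₀(x,F(s)) + F(s))/s ds converges and equals −(x²/60) · ( 27(H+F)·log(F/y₀) + 10L + 20L² + 15·log(1−L) − 30F − 5xF³ ). -/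

import Mathlib

/-- `φ(u) = u(1-u)³`. -/
noncomputable def phiTri (u : ℝ) : ℝ := u * (1 - u) ^ 3

/-- `θ` is the inverse of the restriction of `φ(u) = u(1-u)³` to `[0, 1/4]`,
which is a strictly increasing bijection onto `[0, 27/256]`. -/
noncomputable def thetaTri (x : ℝ) : ℝ :=
  Function.invFunOn phiTri (Set.Icc 0 (1 / 4)) x

/-- `T₀(x,u) = x u³/2 + θ(x u³)(1 − 2 θ(x u³))/2`, the generating function of
edge-rooted planar triangulations. -/
noncomputable def T0 (x u : ℝ) : ℝ :=
  x * u ^ 3 / 2 + thetaTri (x * u ^ 3) * (1 - 2 * thetaTri (x * u ^ 3)) / 2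

theorem phiTri_sub_ge {a b : ℝ} (hb : b ≤ 1 / 4) (hab : a ≤ b) :
    (b - a) ^ 2 ≤ phiTri b - phiTri a := by
  obtain ⟨v, rfl⟩ : ∃ v, b = 1 / 4 - v := ⟨1 / 4 - b, by ring⟩
  obtain ⟨d, rfl⟩ : ∃ d, a = 1 / 4 - (v + d) := ⟨1 / 4 - v - a, by ring⟩
  have hv : 0 ≤ v := by linarith
  have hd : 0 ≤ d := by linarith
  have key : phiTri (1 / 4 - v) - phiTri (1 / 4 - (v + d)) - (1 / 4 - v - (1 / 4 - (v + d))) ^ 2 =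
      d ^ 2 / 8 + 9 / 4 * (v * d) + 2 * (3 * v ^ 2 * d + 3 * v * d ^ 2 + d ^ 3) +
        (4 * v ^ 3 * d + 6 * v ^ 2 * d ^ 2 + 4 * v * d ^ 3 + d ^ 4) := by
    unfold phiTri
    ring
  have : 0 ≤ d ^ 2 / 8 + 9 / 4 * (v * d) + 2 * (3 * v ^ 2 * d + 3 * v * d ^ 2 + d ^ 3) +
        (4 * v ^ 3 * d + 6 * v ^ 2 * d ^ 2 + 4 * v * d ^ 3 + d ^ 4) := by positivity
  linarith

theorem exists_phiTri_eq {p : ℝ} (hp : p ∈ Set.Icc (0 : ℝ) (27 / 256)) :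
    ∃ u ∈ Set.Icc (0 : ℝ) (1 / 4), phiTri u = p := by
  have hc : ContinuousOn phiTri (Set.Icc 0 (1 / 4)) := by
    unfold phiTri
    fun_prop
  have h := intermediate_value_Icc (by norm_num) hc
  have h0 : phiTri 0 = 0 := by norm_num [phiTri]
  have h1 : phiTri (1 / 4) = 27 / 256 := by norm_num [phiTri]
  rw [h0, h1] at h
  exact h hp

theorem thetaTri_mem {p : ℝ} (hp : p ∈ Set.Icc (0 : ℝ) (27 / 256)) :
    thetaTri p ∈ Set.Icc (0 : ℝ) (1 / 4) :=
  Function.invFunOn_mem (exists_phiTri_eq hp)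

theorem phiTri_thetaTri {p : ℝ} (hp : p ∈ Set.Icc (0 : ℝ) (27 / 256)) :
    phiTri (thetaTri p) = p :=
  Function.invFunOn_eq (exists_phiTri_eq hp)

theorem sq_thetaTri_sub_le {p q : ℝ} (hp : p ∈ Set.Icc (0 : ℝ) (27 / 256))
    (hq : q ∈ Set.Icc (0 : ℝ) (27 / 256)) :
    (thetaTri p - thetaTri q) ^ 2 ≤ |p - q| := by
  rcases le_total (thetaTri p) (thetaTri q) with h | h
  · have := phiTri_sub_ge (thetaTri_mem hq).2 h
    rw [phiTri_thetaTri hp, phiTri_thetaTri hq] at this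
    rw [abs_sub_comm]
    linarith [le_abs_self (q - p), sub_sq_comm (thetaTri p) (thetaTri q)]
  · have := phiTri_sub_ge (thetaTri_mem hp).2 h
    rw [phiTri_thetaTri hp, phiTri_thetaTri hq] at this
    linarith [le_abs_self (p - q)]

theorem continuousOn_thetaTri : ContinuousOn thetaTri (Set.Icc 0 (27 / 256)) := by
  rw [Metric.continuousOn_iff]
  intro q hq ε hε
  refine ⟨ε ^ 2, by positivity, fun p hp hpq => ?_⟩
  rw [Real.dist_eq] at hpq ⊢
  exact abs_lt_of_sq_lt_sq ((sq_thetaTri_sub_le hp hq).trans_lt hpq) hε.le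

theorem thetaTri_zero : thetaTri 0 = 0 := by
  have h0 : (0 : ℝ) ∈ Set.Icc (0 : ℝ) (27 / 256) := by norm_num
  have h := phiTri_sub_ge (thetaTri_mem h0).2 (thetaTri_mem h0).1
  rw [phiTri_thetaTri h0] at h
  norm_num [phiTri] at h
  nlinarith [sq_nonneg (thetaTri 0)]

theorem thetaTri_lt {p : ℝ} (hp : 0 ≤ p) (hp' : p < 27 / 256) : thetaTri p < 1 / 4 := by
  refine lt_of_le_of_ne (thetaTri_mem ⟨hp, hp'.le⟩).2 fun h => ?_
  have := phiTri_thetaTri ⟨hp, hp'.le⟩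
  rw [h] at this
  norm_num [phiTri] at this
  linarith

theorem hasDerivAt_phiTri (u : ℝ) : HasDerivAt phiTri ((1 - u) ^ 2 * (1 - 4 * u)) u := by
  have h := (hasDerivAt_id u).mul (((hasDerivAt_id u).const_sub 1).pow 3)
  refine h.congr_deriv ?_
  simp only [id, Pi.pow_apply]
  push_cast
  ring

theorem hasDerivAt_thetaTri {p : ℝ} (hp : 0 < p) (hp' : p < 27 / 256) :
    HasDerivAt thetaTri ((1 - thetaTri p) ^ 2 * (1 - 4 * thetaTri p))⁻¹ p := by
  have hlt := thetaTri_lt hp.le hp'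
  refine HasDerivAt.of_local_left_inverse
    (continuousOn_thetaTri.continuousAt (Icc_mem_nhds hp hp')) (hasDerivAt_phiTri _) ?_ ?_
  · have h1 : 0 < 1 - thetaTri p := by linarith
    have h2 : 0 < 1 - 4 * thetaTri p := by linarith
    positivity
  · filter_upwards [Icc_mem_nhds hp hp'] with q hq using phiTri_thetaTri hq

/-- A primitive of `u ↦ (T₀(x,u) + u)/u`, written in terms of `u` and `t = θ(x u³)`. -/
noncomputable def logPrimitive (x u t : ℝ) : ℝ :=
  u + x * u ^ 3 / 6 + (-4 * t ^ 2 - 2 * t - 3 * Real.log (1 - t)) / 6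

/-- If `s = F(s) exp(-(x³/6) (F(s) + T₀(x,F(s)))⁹)` near `s`, then `(T₀(x,F(s)) + F(s))/s` has
the primitive `logPrimitive - (3x³/20) (F + T₀)¹⁰`. -/
theorem hasDerivAt_primitive {x s : ℝ} (hx : 0 < x) (hs : 0 < s) {F : ℝ → ℝ}
    (hF : DifferentiableAt ℝ F s) (hpos : 0 < F s) (hlt : x * F s ^ 3 < 27 / 256)
    (hinv : ∀ᶠ r in nhds s, F r * Real.exp (-(x ^ 3 / 6) * (F r + T0 x (F r)) ^ 9) = r) :
    HasDerivAt (fun r => logPrimitive x (F r) (thetaTri (x * F r ^ 3)) -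
      3 * x ^ 3 / 20 * (F r + T0 x (F r)) ^ 10) ((T0 x (F s) + F s) / s) s := by
  have hp : 0 < x * F s ^ 3 := by positivity
  have hθlt := thetaTri_lt hp.le hlt
  have hφ : thetaTri (x * F s ^ 3) * (1 - thetaTri (x * F s ^ 3)) ^ 3 = x * F s ^ 3 :=
    phiTri_thetaTri ⟨hp.le, hlt.le⟩
  have dF := hF.hasDerivAt
  have dp : HasDerivAt (fun r => x * F r ^ 3) (x * (3 * F s ^ 2 * deriv F s)) s :=
    ((dF.pow 3).const_mul x).congr_deriv (by push_cast; ring)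
  have dθ : HasDerivAt (fun r => thetaTri (x * F r ^ 3)) _ s :=
    (hasDerivAt_thetaTri hp hlt).comp s dp
  have hG : ∃ g, HasDerivAt (fun r => F r + T0 x (F r)) g s := by
    unfold T0
    exact ⟨_, dF.add ((dp.div_const 2).add ((dθ.mul ((dθ.const_mul 2).const_sub 1)).div_const 2))⟩
  obtain ⟨g, dG⟩ := hG
  have hGdef : F s + T0 x (F s) = F s + (x * F s ^ 3 / 2 +
    thetaTri (x * F s ^ 3) * (1 - 2 * thetaTri (x * F s ^ 3)) / 2) := rfl
  have dE := dF.mul (((dG.pow 9).const_mul (-(x ^ 3 / 6))).exp)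
  have hE := (dE.congr_of_eventuallyEq (f₁ := fun r => r)
    (by filter_upwards [hinv] with r hr using hr.symm)).unique (hasDerivAt_id s)
  have hs' := hinv.self_of_nhds
  simp only [Pi.pow_apply] at hE
  have hlog : deriv F s / F s - 3 * x ^ 3 / 2 * (F s + T0 x (F s)) ^ 8 * g = 1 / s := by
    have hexp : Real.exp (-(x ^ 3 / 6) * (F s + T0 x (F s)) ^ 9) = s / F s := by
      rw [eq_div_iff hpos.ne', mul_comm]
      exact hs'
    rw [hexp] at hE
    push_cast at hE
    field_simp at hE ⊢
    linear_combination hE / 3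
  have h1 : 0 < 1 - thetaTri (x * F s ^ 3) := by linarith
  have h4 : 0 < 1 - 4 * thetaTri (x * F s ^ 3) := by linarith
  have dP := ((dF.add (dp.div_const 6)).add
    (((((dθ.pow 2).const_mul (-4)).sub (dθ.const_mul 2)).sub
      (((dθ.const_sub 1).log h1.ne').const_mul 3)).div_const 6)).sub
    ((dG.pow 10).const_mul (3 * x ^ 3 / 20))
  refine dP.congr_deriv ?_
  have hrhs : (T0 x (F s) + F s) / s = (F s + T0 x (F s)) * (1 / s) := by ring
  rw [hrhs, ← hlog]
  generalize hGv : F s + T0 x (F s) = G at *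
  have hGF : G * (deriv F s / F s) = deriv F s + x * (3 * F s ^ 2 * deriv F s) / 6 +
      thetaTri (x * F s ^ 3) * (1 - 2 * thetaTri (x * F s ^ 3)) / 2 * (deriv F s / F s) := by
    rw [hGdef]
    field_simp
    ring
  have hθ' : x * (3 * F s ^ 2 * deriv F s) = 3 * (thetaTri (x * F s ^ 3) *
      (1 - thetaTri (x * F s ^ 3)) ^ 3) * (deriv F s / F s) := by
    rw [hφ]
    field_simp
  rw [mul_sub G, hGF, hθ']
  have h1' := h1.ne'
  have h4' := h4.ne'
  clear dP dE dG dθ dp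
  generalize thetaTri (x * F s ^ 3) = t at *
  generalize hw : 1 - 4 * t = w at h4' ⊢
  push_cast
  field_simp
  rw [← hw]
  ring

open MeasureTheory in
theorem integral_maximal_K33_closed_form
    (x y₀ : ℝ) (hx : 0 < x) (hy₀ : 0 < y₀) (hy₀le : y₀ ≤ 1)
    (F : ℝ → ℝ)
    (hdiff : ∀ s ∈ Set.Ioc (0 : ℝ) y₀, DifferentiableAt ℝ F s)
    (hcont : ContinuousOn (deriv F) (Set.Ioc 0 y₀))
    (hmono : StrictMonoOn F (Set.Ioc 0 y₀))
    (hpos : ∀ s ∈ Set.Ioc (0 : ℝ) y₀, 0 < F s)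
    (hlim : Filter.Tendsto F (nhdsWithin 0 (Set.Ioi 0)) (nhds 0))
    (hbound : ∀ s ∈ Set.Ioc (0 : ℝ) y₀, x * (F s) ^ 3 ≤ 27 / 256)
    (hinv : ∀ s ∈ Set.Ioc (0 : ℝ) y₀,
      F s * Real.exp (-(x ^ 3 / 6) * (F s + T0 x (F s)) ^ 9) = s) :
    IntegrableOn (fun s => (T0 x (F s) + F s) / s) (Set.Ioc 0 y₀) ∧
    (x ^ 2 / 2) * ∫ s in Set.Ioc (0 : ℝ) y₀, (T0 x (F s) + F s) / s =
      -(x ^ 2 / 60) *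
        (27 * (T0 x (F y₀) + F y₀) * Real.log (F y₀ / y₀) +
          10 * thetaTri (x * (F y₀) ^ 3) + 20 * thetaTri (x * (F y₀) ^ 3) ^ 2 +
          15 * Real.log (1 - thetaTri (x * (F y₀) ^ 3)) - 30 * F y₀ -
          5 * x * (F y₀) ^ 3) := by
  set G : ℝ → ℝ := Function.update F 0 0 with hGdef
  have hG0 : G 0 = 0 := by simp [hGdef]
  have hGF : ∀ s, 0 < s → G s = F s := fun s hs => by simp [hGdef, hs.ne']
  have hGev : ∀ s, 0 < s → G =ᶠ[nhds s] F := fun s hs => by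
    filter_upwards [Ioi_mem_nhds hs] with r hr using hGF r hr
  have hGc : ContinuousOn G (Set.Icc 0 y₀) := by
    intro s hs
    rcases hs.1.eq_or_lt with rfl | h
    · rw [hGdef, continuousWithinAt_update_same]
      refine hlim.mono_left (nhdsWithin_mono _ ?_)
      rintro r ⟨hr, hr0⟩
      exact lt_of_le_of_ne hr.1 (Ne.symm hr0)
    · exact ((hdiff s ⟨h, hs.2⟩).continuousAt.congr (hGev s h).symm).continuousWithinAt
  have hmaps : Set.MapsTo (fun s => x * G s ^ 3) (Set.Icc 0 y₀) (Set.Icc 0 (27 / 256)) := by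
    intro s hs
    rcases hs.1.eq_or_lt with rfl | h
    · norm_num [hG0]
    · have := hpos s ⟨h, hs.2⟩
      simp only [hGF s h]
      exact ⟨by positivity, hbound s ⟨h, hs.2⟩⟩
  have hθc : ContinuousOn (fun s => thetaTri (x * G s ^ 3)) (Set.Icc 0 y₀) :=
    continuousOn_thetaTri.comp (continuousOn_const.mul (hGc.pow 3)) hmaps
  set P : ℝ → ℝ := fun r => logPrimitive x (G r) (thetaTri (x * G r ^ 3)) -
      3 * x ^ 3 / 20 * (G r + T0 x (G r)) ^ 10 with hP
  have hPc : ContinuousOn P (Set.Icc 0 y₀) := by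
    have hne : ∀ s ∈ Set.Icc 0 y₀, 1 - thetaTri (x * G s ^ 3) ≠ 0 := fun s hs => by
      linarith [(thetaTri_mem (hmaps hs)).2]
    have hlogc := (continuousOn_const.sub hθc).log hne
    simp only [hP, logPrimitive, T0]
    fun_prop
  have hderiv : ∀ s ∈ Set.Ioo 0 y₀, HasDerivAt P ((T0 x (F s) + F s) / s) s := by
    intro s hs
    have hsm : s ∈ Set.Ioc 0 y₀ := ⟨hs.1, hs.2.le⟩
    have hlt : x * F s ^ 3 < 27 / 256 := by
      refine lt_of_lt_of_le ?_ (hbound y₀ ⟨hy₀, le_rfl⟩)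
      have := hmono hsm ⟨hy₀, le_rfl⟩ hs.2
      have := hpos s hsm
      gcongr
    refine (hasDerivAt_primitive hx hs.1 (hdiff s hsm) (hpos s hsm) hlt ?_).congr_of_eventuallyEq ?_
    · filter_upwards [Ioo_mem_nhds hs.1 hs.2] with r hr using hinv r ⟨hr.1, hr.2.le⟩
    · filter_upwards [hGev s hs.1] with r hr
      simp only [hP, hr]
  have hnonneg : ∀ s ∈ Set.Ioo 0 y₀, 0 ≤ (T0 x (F s) + F s) / s := by
    intro s hs
    have hsm : s ∈ Set.Ioc 0 y₀ := ⟨hs.1, hs.2.le⟩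
    have hFs := hpos s hsm
    obtain ⟨h0, h1⟩ := thetaTri_mem (p := x * F s ^ 3) ⟨by positivity, hbound s hsm⟩
    have h2 : 0 ≤ 1 - 2 * thetaTri (x * F s ^ 3) := by linarith
    have := hs.1
    unfold T0
    positivity
  have hint : IntegrableOn (fun s => (T0 x (F s) + F s) / s) (Set.Ioc 0 y₀) :=
    intervalIntegral.integrableOn_deriv_of_nonneg hPc hderiv hnonneg
  refine ⟨hint, ?_⟩
  have hFTC := intervalIntegral.integral_eq_sub_of_hasDerivAt_of_le hy₀.le hPc hderiv
    ((intervalIntegrable_iff_integrableOn_Ioc_of_le hy₀.le).2 hint)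
  rw [intervalIntegral.integral_of_le hy₀.le] at hFTC
  have hP0 : P 0 = 0 := by simp [hP, hG0, logPrimitive, T0, thetaTri_zero]
  have hF := hpos y₀ ⟨hy₀, le_rfl⟩
  have hlog : Real.log (F y₀ / y₀) = x ^ 3 / 6 * (F y₀ + T0 x (F y₀)) ^ 9 := by
    have h := congrArg Real.log (hinv y₀ ⟨hy₀, le_rfl⟩)
    rw [Real.log_mul hF.ne' (Real.exp_ne_zero _), Real.log_exp] at h
    rw [Real.log_div hF.ne' hy₀.ne']
    linarith
  rw [hFTC, hP0, hlog]
  simp only [hP, hGF y₀ hy₀, logPrimitive]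
  ring
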